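/- arXiv:1804.06671 — 2 statements merged into one kernel-verified Lean document; each statement's English description precedes it below -/
import Mathlib

section
/- Let φ be a conformal mapping from the unit disk Δ onto a simply connected domain Ω ⊊ ℂ. Assume the push-forward operator T = (φ⁻¹)* is well-defined from CM(Δ) to CM(Ω), i.e., for every Carleson measure ν on Δ the measure μ(A) = ∫_{φ⁻¹(A)} |φ′| dν is a Carleson measure on Ω. Then T is a bounded linear operator: there exists a constant C > 0 such that ‖(φ⁻¹)*ν‖_* ≤ C‖ν‖_* for every Carleson measure ν on Δ. -/
open MeasureTheory Metric Set
open scoped ENNReal NNReal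

/-- The open unit disk `Δ` in the complex plane. -/
def unitDisk : Set ℂ := Metric.ball (0 : ℂ) 1

/-- The Carleson "norm" `‖μ‖_* = sup { μ(Ω ∩ D(z,r))/r : z ∈ ∂Ω, 0 < r < diam ∂Ω }`
of a positive Borel measure relative to a domain `Ω`. -/
noncomputable def carlesonNorm (Ω : Set ℂ) (μ : Measure ℂ) : ℝ≥0∞ :=
  ⨆ z ∈ frontier Ω, ⨆ r : ℝ,
    ⨆ (_ : 0 < r ∧ ENNReal.ofReal r < EMetric.diam (frontier Ω)),
      μ (Ω ∩ Metric.ball z r) / ENNReal.ofReal r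

/-- `μ` is a Carleson measure on `Ω`. -/
def IsCarleson (Ω : Set ℂ) (μ : Measure ℂ) : Prop :=
  carlesonNorm Ω μ < ⊤

/-- The push-forward `(φ⁻¹)* ν` of a measure `ν` on `D` under a conformal map `φ` of `D`:
the measure `A ↦ ∫_{φ⁻¹(A)} |φ′| dν`. -/
noncomputable def pushForward (D : Set ℂ) (φ : ℂ → ℂ) (ν : Measure ℂ) : Measure ℂ :=
  Measure.map φ ((ν.restrict D).withDensity fun z => (‖deriv φ z‖₊ : ℝ≥0∞))

theorem carlesonNorm_mono (Ω : Set ℂ) {μ ν : Measure ℂ} (h : μ ≤ ν) :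
    carlesonNorm Ω μ ≤ carlesonNorm Ω ν := by
  unfold carlesonNorm
  gcongr

theorem carlesonNorm_smul (Ω : Set ℂ) (c : ℝ≥0∞) (μ : Measure ℂ) :
    carlesonNorm Ω (c • μ) = c * carlesonNorm Ω μ := by
  simp only [carlesonNorm, ENNReal.mul_iSup, Measure.smul_apply, smul_eq_mul, mul_div_assoc]

theorem carlesonNorm_sum_le {Ω : Set ℂ} (hΩ : IsOpen Ω) (μ : ℕ → Measure ℂ) :
    carlesonNorm Ω (Measure.sum μ) ≤ ∑' n, carlesonNorm Ω (μ n) := by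
  refine iSup₂_le fun z hz => iSup₂_le fun r hr => ?_
  rw [Measure.sum_apply _ (hΩ.inter isOpen_ball).measurableSet, div_eq_mul_inv,
    ← ENNReal.tsum_mul_right]
  refine ENNReal.tsum_le_tsum fun n => ?_
  rw [← div_eq_mul_inv]
  exact le_iSup₂_of_le z hz (le_iSup₂_of_le r hr le_rfl)

theorem pushForward_smul (D : Set ℂ) (φ : ℂ → ℂ) (c : ℝ≥0∞) (ν : Measure ℂ) :
    pushForward D φ (c • ν) = c • pushForward D φ ν := by
  rw [pushForward, Measure.restrict_smul, withDensity_smul_measure, Measure.map_smul,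
    pushForward]

theorem pushForward_mono {D : Set ℂ} (hD : MeasurableSet D) {φ : ℂ → ℂ}
    (hφ : ContinuousOn φ D) {μ ν : Measure ℂ} (h : μ ≤ ν) :
    pushForward D φ μ ≤ pushForward D φ ν := by
  refine Measure.map_mono_of_aemeasurable ?_
    ((hφ.aemeasurable hD).mono_ac (withDensity_absolutelyContinuous _ _))
  refine Measure.le_iff.2 fun s hs => ?_
  rw [withDensity_apply _ hs, withDensity_apply _ hs]
  exact lintegral_mono' (Measure.restrict_mono_measure (Measure.restrict_mono_measure h _) _) le_rfl

/-- If the push-forward operator `T = (φ⁻¹)*` is well-defined from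
`CM(Δ)` to `CM(Ω)`, then it is bounded: there is `C > 0` with
`‖(φ⁻¹)*ν‖_* ≤ C ‖ν‖_*` for every Carleson measure `ν` on the unit disk. -/
theorem stmt_1 (φ : ℂ → ℂ) (Ω : Set ℂ)
    (hΩopen : IsOpen Ω) (hΩne : Ω.Nonempty) (hΩproper : Ω ≠ Set.univ)
    (hΩconn : IsConnected Ω) (hΩsc : SimplyConnectedSpace Ω)
    (hdiff : DifferentiableOn ℂ φ unitDisk)
    (hinj : Set.InjOn φ unitDisk)
    (honto : φ '' unitDisk = Ω)
    (hwd : ∀ ν : Measure ℂ, IsCarleson unitDisk ν →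
      IsCarleson Ω (pushForward unitDisk φ ν)) :
    ∃ C : ℝ, 0 < C ∧ ∀ ν : Measure ℂ, IsCarleson unitDisk ν →
      carlesonNorm Ω (pushForward unitDisk φ ν) ≤
        ENNReal.ofReal C * carlesonNorm unitDisk ν := by
  by_contra! hC
  have hex : ∀ n : ℕ, ∃ ν : Measure ℂ, IsCarleson unitDisk ν ∧
      4 ^ n * carlesonNorm unitDisk ν < carlesonNorm Ω (pushForward unitDisk φ ν) := by
    intro n
    obtain ⟨ν, hν, hlt⟩ := hC (4 ^ n) (by positivity)
    refine ⟨ν, hν, ?_⟩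
    rwa [ENNReal.ofReal_pow (by norm_num), ENNReal.ofReal_ofNat] at hlt
  choose ν hν hlt using hex
  let c : ℕ → ℝ≥0∞ := fun n => 2⁻¹ ^ n / carlesonNorm unitDisk (ν n)
  let μ : Measure ℂ := Measure.sum fun n => c n • ν n
  have hμ : IsCarleson unitDisk μ := by
    refine (carlesonNorm_sum_le isOpen_ball _).trans_lt ?_
    calc ∑' n, carlesonNorm unitDisk (c n • ν n) ≤ ∑' n : ℕ, (2⁻¹ : ℝ≥0∞) ^ n := by
          refine ENNReal.tsum_le_tsum fun n => ?_
          rw [carlesonNorm_smul]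
          exact (mul_comm _ _).trans_le ENNReal.mul_div_le
      _ < ⊤ := by
          rw [ENNReal.tsum_geometric, ENNReal.one_sub_inv_two, inv_inv]
          exact ENNReal.ofNat_lt_top
  have hlarge : ∀ n : ℕ, (2 : ℝ≥0∞) ^ n ≤ carlesonNorm Ω (pushForward unitDisk φ μ) := by
    intro n
    have hle : carlesonNorm Ω (pushForward unitDisk φ (c n • ν n)) ≤
        carlesonNorm Ω (pushForward unitDisk φ μ) :=
      carlesonNorm_mono _ (pushForward_mono measurableSet_ball hdiff.continuousOn
        (Measure.le_sum (fun n => c n • ν n) n))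
    refine le_trans ?_ hle
    rw [pushForward_smul, carlesonNorm_smul]
    rcases eq_or_ne (carlesonNorm unitDisk (ν n)) 0 with h0 | h0
    · have hpos : carlesonNorm Ω (pushForward unitDisk φ (ν n)) ≠ 0 := (pos_of_gt (hlt n)).ne'
      have hc : c n = ⊤ := by
        simp only [c, h0]
        exact ENNReal.div_zero (pow_ne_zero _ (by simp))
      rw [hc, ENNReal.top_mul hpos]
      exact le_top
    · calc (2 : ℝ≥0∞) ^ n = c n * (4 ^ n * carlesonNorm unitDisk (ν n)) := by
            rw [mul_left_comm, ENNReal.div_mul_cancel h0 (hν n).ne, ← mul_pow]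
            congr 1
            rw [show (4 : ℝ≥0∞) = 2 * 2 by norm_num, mul_assoc,
              ENNReal.mul_inv_cancel two_ne_zero ENNReal.ofNat_ne_top, mul_one]
        _ ≤ _ := by gcongr; exact (hlt n).le
  obtain ⟨n, hn⟩ := ENNReal.exists_nat_gt (hwd μ hμ).ne
  have hn2 : (n : ℝ≥0∞) ≤ 2 ^ n := mod_cast n.lt_two_pow_self.le
  exact (hn.trans_le (hn2.trans (hlarge n))).false
end

section
/- Let φ be a conformal mapping from the unit disk Δ onto a simply connected domain Ω ⊊ ℂ, and assume the push-forward operator (φ⁻¹)* is well-defined from CM(Δ) to CM(Ω). If γ ⊂ Δ is an Ahlfors-regular curve, then Γ = φ(γ) ⊂ Ω is an Ahlfors-regular curve. Quantitatively, if γ has Ahlfors-regular constant C and ‖T‖ is the operator norm of the push-forward operator, then Λ¹(Γ ∩ D(w,r)) ≤ 2·max{3C‖T‖, 27C}·r for all w ∈ ℂ and r > 0. -/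
open MeasureTheory Metric Set
open scoped ENNReal NNReal

section Auxiliary

open Filter
open scoped Topology Real

/-- An injective holomorphic function on a connected open set is an open map. -/
theorem isOpen_image_of_injOn_differentiableOn {f : ℂ → ℂ} {U : Set ℂ} (hU : IsOpen U)
    (hUc : IsPreconnected U) (hf : DifferentiableOn ℂ f U) (hinj : InjOn f U) {s : Set ℂ}
    (hsU : s ⊆ U) (hs : IsOpen s) : IsOpen (f '' s) := by
  rcases s.eq_empty_or_nonempty with rfl | ⟨x, hx⟩
  · simp
  rcases (hf.analyticOnNhd hU).is_constant_or_isOpen hUc with ⟨w, hw⟩ | h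
  · exfalso
    obtain ⟨y, hy, hyx⟩ : ∃ y ∈ U, y ≠ x := by
      have hne : (𝓝[≠] x).NeBot := inferInstance
      have h1 : ∀ᶠ y in 𝓝[≠] x, y ∈ U := nhdsWithin_le_nhds (hU.mem_nhds (hsU hx))
      obtain ⟨y, hy⟩ := (h1.and self_mem_nhdsWithin).exists
      exact ⟨y, hy.1, hy.2⟩
    exact hyx (hinj hy (hsU hx) ((hw y hy).trans (hw x (hsU hx)).symm))
  · exact h s hsU hs

/-- The change of variables formula for injective holomorphic functions. -/
theorem lintegral_image_eq_lintegral_norm_deriv_sq {f : ℂ → ℂ} {U : Set ℂ} (hU : MeasurableSet U)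
    (hf : ∀ z ∈ U, DifferentiableAt ℂ f z) (hinj : InjOn f U) (g : ℂ → ℝ≥0∞) :
    ∫⁻ y in f '' U, g y = ∫⁻ z in U, ENNReal.ofReal (‖deriv f z‖ ^ 2) * g (f z) := by
  rw [lintegral_image_eq_lintegral_abs_det_fderiv_mul volume hU
    (fun z hz => ((hf z hz).hasDerivAt.hasFDerivAt.restrictScalars ℝ).hasFDerivWithinAt) hinj g]
  refine lintegral_congr fun z => ?_
  congr 2
  have : (ContinuousLinearMap.restrictScalars ℝ
      (ContinuousLinearMap.toSpanSingleton ℂ (deriv f z))).det = ‖deriv f z‖ ^ 2 := by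
    rw [ContinuousLinearMap.det]
    change LinearMap.det ((ContinuousLinearMap.toSpanSingleton ℂ (deriv f z) :
      ℂ →ₗ[ℂ] ℂ).restrictScalars ℝ) = _
    rw [LinearMap.det_restrictScalars]
    simp [Algebra.norm_complex_eq, Complex.normSq_eq_norm_sq]
  rw [this, abs_of_nonneg (by positivity)]

/-- Integration in polar coordinates as an iterated integral. -/
theorem lintegral_eq_lintegral_circleMap {H : ℂ → ℝ≥0∞} (hH : Measurable H) :
    ∫⁻ z, H z = ∫⁻ r in Ioi (0 : ℝ), ENNReal.ofReal r *
      ∫⁻ θ in Ioo (-π) π, H (circleMap 0 r θ) := by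
  rw [← Complex.lintegral_comp_polarCoord_symm]
  have h1 : ∀ p : ℝ × ℝ, Complex.polarCoord.symm p = circleMap 0 p.1 p.2 := fun p => by
    rw [Complex.polarCoord_symm_apply, circleMap, zero_add, Complex.exp_mul_I]
    push_cast; rfl
  simp_rw [h1, smul_eq_mul]
  have hc : Continuous fun p : ℝ × ℝ => circleMap 0 p.1 p.2 := by
    unfold circleMap; fun_prop
  rw [polarCoord_target, Measure.volume_eq_prod, ← Measure.prod_restrict, lintegral_prod]
  · refine lintegral_congr fun r => ?_
    dsimp only
    rw [lintegral_const_mul]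
    exact hH.comp (by unfold circleMap; fun_prop)
  · exact ((ENNReal.measurable_ofReal.comp measurable_fst).mul (hH.comp hc.measurable)).aemeasurable

theorem lintegral_annulus_eq {G : ℂ → ℝ} {a b : ℝ} (ha : 0 < a)
    (hG : ContinuousOn G {z | ‖z‖ ∈ Ioo a b}) :
    ∫⁻ z in {z | ‖z‖ ∈ Ioo a b}, ENNReal.ofReal (G z / ‖z‖ ^ 2) =
      ∫⁻ r in Ioo a b, ENNReal.ofReal r⁻¹ *
        ∫⁻ θ in Ioo (-π) π, ENNReal.ofReal (G (circleMap 0 r θ)) := by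
  have hA : MeasurableSet {z : ℂ | ‖z‖ ∈ Ioo a b} := measurable_norm measurableSet_Ioo
  classical
  have hm : Measurable ({z : ℂ | ‖z‖ ∈ Ioo a b}.indicator
      fun z => ENNReal.ofReal (G z / ‖z‖ ^ 2)) := by
    have h2 : ContinuousOn (fun z => ENNReal.ofReal (G z / ‖z‖ ^ 2)) {z : ℂ | ‖z‖ ∈ Ioo a b} := by
      refine ENNReal.continuous_ofReal.comp_continuousOn (hG.div (by fun_prop) ?_)
      intro z hz
      have : 0 < ‖z‖ := ha.trans hz.1
      positivity
    rw [← Set.piecewise_eq_indicator]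
    exact h2.measurable_piecewise continuousOn_const hA
  rw [← lintegral_indicator hA, lintegral_eq_lintegral_circleMap hm,
    ← lintegral_indicator measurableSet_Ioi, ← lintegral_indicator measurableSet_Ioo]
  refine lintegral_congr fun r => ?_
  by_cases hr : r ∈ Ioo a b
  · have hr0 : 0 < r := ha.trans hr.1
    rw [indicator_of_mem hr, indicator_of_mem (show r ∈ Ioi 0 from hr0)]
    have h3 : ∀ θ : ℝ, ({z : ℂ | ‖z‖ ∈ Ioo a b}.indicator
        fun z => ENNReal.ofReal (G z / ‖z‖ ^ 2)) (circleMap 0 r θ) =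
        ENNReal.ofReal (r ^ 2)⁻¹ * ENNReal.ofReal (G (circleMap 0 r θ)) := fun θ => by
      have h4 : ‖circleMap 0 r θ‖ = r := by rw [norm_circleMap_zero, abs_of_pos hr0]
      rw [indicator_of_mem (by rw [mem_ofPred_eq, h4]; exact hr), h4, div_eq_inv_mul,
        ENNReal.ofReal_mul (by positivity)]
    simp_rw [h3]
    rw [lintegral_const_mul' _ _ ENNReal.ofReal_ne_top, ← mul_assoc,
      ← ENNReal.ofReal_mul hr0.le]
    congr 2
    field_simp
  · rw [indicator_of_notMem hr]
    by_cases hr0 : r ∈ Ioi (0 : ℝ)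
    · rw [indicator_of_mem hr0]
      have h3 : ∀ θ : ℝ, ({z : ℂ | ‖z‖ ∈ Ioo a b}.indicator
          fun z => ENNReal.ofReal (G z / ‖z‖ ^ 2)) (circleMap 0 r θ) = 0 := fun θ => by
        have h4 : ‖circleMap 0 r θ‖ = r := by rw [norm_circleMap_zero, abs_of_pos hr0]
        rw [indicator_of_notMem (by rw [mem_ofPred_eq, h4]; exact hr)]
      simp_rw [h3]
      simp
    · rw [indicator_of_notMem hr0]

theorem lintegral_inv_Ioo {a b : ℝ} (ha : 0 < a) (hab : a ≤ b) :
    ∫⁻ r in Ioo a b, ENNReal.ofReal r⁻¹ = ENNReal.ofReal (Real.log (b / a)) := by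
  rw [← integral_inv_of_pos ha (ha.trans_le hab), intervalIntegral.integral_of_le hab,
    ofReal_integral_eq_lintegral_ofReal, restrict_Ioo_eq_restrict_Ioc]
  · have : IntervalIntegrable (fun x : ℝ => x⁻¹) volume a b := by
      refine intervalIntegral.intervalIntegrable_inv (fun x hx => ?_) continuousOn_id
      rw [uIcc_of_le hab] at hx
      exact (ha.trans_le hx.1).ne'
    exact (intervalIntegrable_iff_integrableOn_Ioc_of_le hab).1 this
  · filter_upwards [ae_restrict_mem measurableSet_Ioc] with x hx
    exact inv_nonneg.2 (ha.trans hx.1).le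

theorem lintegral_annulus_inv_sq {a b : ℝ} (ha : 0 < a) (hab : a ≤ b) :
    ∫⁻ z : ℂ in {z | ‖z‖ ∈ Ioo a b}, ENNReal.ofReal (1 / ‖z‖ ^ 2) =
      ENNReal.ofReal (2 * π * Real.log (b / a)) := by
  rw [lintegral_annulus_eq (G := fun _ => 1) ha continuousOn_const]
  simp only [ENNReal.ofReal_one, lintegral_const, Measure.restrict_apply_univ, Real.volume_Ioo,
    one_mul]
  rw [lintegral_mul_const' _ _ ENNReal.ofReal_ne_top, lintegral_inv_Ioo ha hab,
    ← ENNReal.ofReal_mul (Real.log_nonneg ((one_le_div ha).2 hab))]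
  congr 1; ring

theorem two_pi_le_lintegral_norm_sq {q : ℂ → ℂ} (hq : DifferentiableOn ℂ q (ball 0 1))
    (hq0 : q 0 = 1) {r : ℝ} (hr : r ∈ Ioo (0 : ℝ) 1) :
    ENNReal.ofReal (2 * π) ≤ ∫⁻ θ in Ioo (-π) π, ENNReal.ofReal (‖q (circleMap 0 r θ)‖ ^ 2) := by
  have hsub : closedBall (0 : ℂ) |r| ⊆ ball 0 1 :=
    closedBall_subset_ball (by rw [abs_of_pos hr.1]; exact hr.2)
  have hmean : Real.circleAverage q 0 r = 1 := by
    rw [DiffContOnCl.circleAverage, hq0]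
    exact (hq.mono hsub).diffContOnCl_ball subset_rfl
  have hcont : Continuous fun θ => q (circleMap 0 r θ) :=
    hq.continuousOn.comp_continuous (continuous_circleMap 0 r)
      fun θ => hsub (by simp)
  have hint : ∫ θ in (-π)..π, q (circleMap 0 r θ) = 2 * π := by
    have hper : Function.Periodic (fun θ => q (circleMap 0 r θ)) (2 * π) := fun θ => by
      simp only [periodic_circleMap 0 r θ]
    have h1 := hper.intervalIntegral_add_eq (-π) 0
    rw [show -π + 2 * π = π by ring, zero_add] at h1
    rw [h1]
    rw [Real.circleAverage_def] at hmean
    have h2 : ((2 * π : ℝ) : ℂ) * ((2 * π)⁻¹ • ∫ θ in (0 : ℝ)..2 * π, q (circleMap 0 r θ)) =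
        2 * π := by rw [hmean]; push_cast; ring
    rw [← h2, Complex.real_smul]
    push_cast
    have : (π : ℂ) ≠ 0 := by exact_mod_cast Real.pi_ne_zero
    field_simp
  have hre : ∫ θ in (-π)..π, (q (circleMap 0 r θ)).re = 2 * π := by
    have := Complex.reCLM.intervalIntegral_comp_comm (hcont.intervalIntegrable (μ := volume) (-π) π)
    simp only [Complex.reCLM_apply] at this
    rw [this, hint]; simp
  have hpi : -π ≤ π := by linarith [Real.pi_pos]
  have hci : Continuous fun θ => ‖q (circleMap 0 r θ)‖ ^ 2 := hcont.norm.pow 2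
  have hcr2 : Continuous fun θ => 2 * (q (circleMap 0 r θ)).re :=
    continuous_const.mul (Complex.continuous_re.comp hcont)
  have hcr : Continuous fun θ => 2 * (q (circleMap 0 r θ)).re - 1 := hcr2.sub continuous_const
  have hle : 2 * π ≤ ∫ θ in (-π)..π, ‖q (circleMap 0 r θ)‖ ^ 2 := by
    have h1 : ∫ θ in (-π)..π, (2 * (q (circleMap 0 r θ)).re - 1) = 2 * π := by
      rw [intervalIntegral.integral_sub (hcr2.intervalIntegrable _ _) (by simp),
        intervalIntegral.integral_const_mul, hre]
      simp; ring
    rw [← h1]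
    refine intervalIntegral.integral_mono_on hpi (hcr.intervalIntegrable _ _)
      (hci.intervalIntegrable _ _) fun θ _ => ?_
    rw [← Complex.normSq_eq_norm_sq, Complex.normSq_apply]
    nlinarith [sq_nonneg ((q (circleMap 0 r θ)).re - 1), sq_nonneg (q (circleMap 0 r θ)).im]
  rw [restrict_Ioo_eq_restrict_Ioc, ← ofReal_integral_eq_lintegral_ofReal]
  · rw [← intervalIntegral.integral_of_le hpi]
    exact ENNReal.ofReal_le_ofReal hle
  · exact (intervalIntegrable_iff_integrableOn_Ioc_of_le hpi).1 (hci.intervalIntegrable _ _)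
  · exact Filter.Eventually.of_forall fun θ => by positivity

theorem le_lintegral_annulus_norm_sq {q : ℂ → ℂ} (hq : DifferentiableOn ℂ q (ball 0 1))
    (hq0 : q 0 = 1) {ε : ℝ} (hε : ε ∈ Ioo (0 : ℝ) 1) :
    ENNReal.ofReal (2 * π * Real.log (1 / ε)) ≤
      ∫⁻ z in {z | ‖z‖ ∈ Ioo ε 1}, ENNReal.ofReal (‖q z‖ ^ 2 / ‖z‖ ^ 2) := by
  rw [lintegral_annulus_eq (G := fun z => ‖q z‖ ^ 2) hε.1]
  · calc ENNReal.ofReal (2 * π * Real.log (1 / ε))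
        = ∫⁻ r in Ioo ε 1, ENNReal.ofReal r⁻¹ * ENNReal.ofReal (2 * π) := by
          rw [lintegral_mul_const' _ _ ENNReal.ofReal_ne_top, lintegral_inv_Ioo hε.1 hε.2.le,
            mul_comm (2 * π), ENNReal.ofReal_mul]
          exact Real.log_nonneg ((one_le_div hε.1).2 hε.2.le)
      _ ≤ _ := by
          refine setLIntegral_mono' measurableSet_Ioo fun r hr => ?_
          gcongr
          exact two_pi_le_lintegral_norm_sq hq hq0 ⟨hε.1.trans hr.1, hr.2⟩
  · refine (hq.continuousOn.mono fun z hz => ?_).norm.pow 2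
    simpa using hz.2

/-- Lower bounds for an injective holomorphic function outside small disks, in terms of its
derivative at the origin. -/
theorem exists_mul_lt_norm_of_injOn {u : ℂ → ℂ} (hu : DifferentiableOn ℂ u (ball 0 1))
    (hinj : InjOn u (ball 0 1)) (hu0 : u 0 = 0) {c : ℝ} (hc : 0 < c) (hcu : c < ‖deriv u 0‖) :
    ∃ ε ∈ Ioo (0 : ℝ) 1, (∀ z ∈ ball (0 : ℂ) 1, ε ≤ ‖z‖ → c * ε < ‖u z‖) ∧
      closedBall 0 (c * ε) ⊆ u '' ball 0 1 := by
  obtain ⟨c', hcc', hc'u⟩ := exists_between hcu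
  have h0 : (0 : ℂ) ∈ ball (0 : ℂ) 1 := mem_ball_self one_pos
  have hd : HasDerivAt u (deriv u 0) 0 :=
    (hu.differentiableAt (isOpen_ball.mem_nhds h0)).hasDerivAt
  have hlow : ∀ᶠ z in 𝓝 (0 : ℂ), c' * ‖z‖ ≤ ‖u z‖ := by
    have h1 := (hasDerivAt_iff_isLittleO.1 hd).def (sub_pos.2 hc'u)
    filter_upwards [h1] with z hz
    simp only [hu0, sub_zero, smul_eq_mul] at hz
    have h2 : ‖z * deriv u 0‖ ≤ ‖u z‖ + ‖u z - z * deriv u 0‖ := by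
      calc ‖z * deriv u 0‖ = ‖u z - (u z - z * deriv u 0)‖ := by congr 1; ring
        _ ≤ _ := norm_sub_le _ _
    rw [norm_mul] at h2
    nlinarith
  obtain ⟨δ, hδ, hball⟩ := Metric.eventually_nhds_iff_ball.1 hlow
  set δ' := min δ 1 with hδ'
  have hδ'0 : 0 < δ' := lt_min hδ one_pos
  have hsub : ball (0 : ℂ) δ' ⊆ ball 0 1 := ball_subset_ball (min_le_right _ _)
  have hopen : IsOpen (u '' ball 0 δ') :=
    isOpen_image_of_injOn_differentiableOn isOpen_ball (convex_ball _ _).isPreconnected hu hinj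
      hsub isOpen_ball
  obtain ⟨σ, hσ, hσs⟩ := Metric.isOpen_iff.1 hopen 0 ⟨0, mem_ball_self hδ'0, hu0⟩
  obtain ⟨ε, hε0, hε⟩ : ∃ ε > 0, ε < min (δ' / 2) (σ / (2 * c)) / 2 :=
    exists_between (by positivity)
  have hε1 : 2 * ε < δ' / 2 := by linarith [min_le_left (δ' / 2) (σ / (2 * c))]
  have hε2 : 2 * ε < σ / (2 * c) := by linarith [min_le_right (δ' / 2) (σ / (2 * c))]
  rw [lt_div_iff₀ (by positivity)] at hε2
  have hδ1 : δ' ≤ 1 := min_le_right _ _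
  have key : c * (2 * ε) < σ := by nlinarith [mul_pos hc hε0]
  refine ⟨ε, ⟨hε0, by linarith⟩, fun z hz hzε => ?_, ?_⟩
  · by_cases hzs : z ∈ ball (0 : ℂ) δ'
    · have := hball z (ball_subset_ball (min_le_left _ _) hzs)
      nlinarith
    · by_contra! hcon
      obtain ⟨y, hy, hyz⟩ := hσs (show u z ∈ ball 0 σ by
        rw [mem_ball_zero_iff]; nlinarith [mul_pos hc hε0])
      exact hzs (hinj (hsub hy) hz hyz ▸ hy)
  · exact ((closedBall_subset_ball (by nlinarith [mul_pos hc hε0])).trans hσs).trans (image_mono hsub)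

theorem norm_deriv_le_one_of_mul_ne_one {u : ℂ → ℂ} (hu : DifferentiableOn ℂ u (ball 0 1))
    (hinj : InjOn u (ball 0 1)) (hu0 : u 0 = 0)
    (hmul : ∀ z ∈ ball (0 : ℂ) 1, ∀ w ∈ ball (0 : ℂ) 1, u z * u w ≠ 1) : ‖deriv u 0‖ ≤ 1 := by
  by_contra! hgt
  obtain ⟨c, hc1, hc⟩ := exists_between hgt
  have hc0 : 0 < c := one_pos.trans hc1
  obtain ⟨ε, hε, hlow, hcov⟩ := exists_mul_lt_norm_of_injOn hu hinj hu0 hc0 hc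
  set s := c * ε with hs
  have hs0 : 0 < s := mul_pos hc0 hε.1
  have h0 : (0 : ℂ) ∈ ball (0 : ℂ) 1 := mem_ball_self one_pos
  set A : Set ℂ := {z | ‖z‖ ∈ Ioo ε 1} with hA
  have hAm : MeasurableSet A := measurable_norm measurableSet_Ioo
  have hAball : A ⊆ ball 0 1 := fun z hz => by simpa using hz.2
  have hud : ∀ z ∈ ball (0 : ℂ) 1, DifferentiableAt ℂ u z := fun z hz =>
    hu.differentiableAt (isOpen_ball.mem_nhds hz)
  have hA0 : ∀ z ∈ A, z ≠ 0 := fun z hz h => by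
    have := hz.1; rw [h, norm_zero] at this; linarith [hε.1]
  have hune : ∀ z ∈ ball (0 : ℂ) 1, z ≠ 0 → u z ≠ 0 := fun z hz hz0 h =>
    hz0 (hinj hz h0 (h.trans hu0.symm))
  have hslope : ∀ z : ℂ, z ≠ 0 → dslope u 0 z = u z / z := fun z hz => by
    rw [dslope_of_ne _ hz, slope_def_field, hu0, sub_zero, sub_zero]
  have hslope0 : ∀ z ∈ ball (0 : ℂ) 1, dslope u 0 z ≠ 0 := fun z hz => by
    by_cases hz0 : z = 0
    · rw [hz0, dslope_same]
      exact norm_pos_iff.1 (one_pos.trans hgt)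
    · rw [hslope z hz0]
      exact div_ne_zero (hune z hz hz0) hz0
  have hq : DifferentiableOn ℂ (fun z => deriv u z / dslope u 0 z) (ball 0 1) :=
    (hu.deriv isOpen_ball).div
      ((Complex.differentiableOn_dslope (isOpen_ball.mem_nhds h0)).2 hu) hslope0
  have hmain := le_lintegral_annulus_norm_sq hq
    (by rw [dslope_same]; exact div_self (norm_pos_iff.1 (one_pos.trans hgt))) hε
  have harea1 : ∫⁻ z in A, ENNReal.ofReal (‖deriv u z / dslope u 0 z‖ ^ 2 / ‖z‖ ^ 2) =
      ∫⁻ y in u '' A, ENNReal.ofReal (1 / ‖y‖ ^ 2) := by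
    rw [lintegral_image_eq_lintegral_norm_deriv_sq hAm (fun z hz => hud z (hAball hz))
      (hinj.mono hAball)]
    refine setLIntegral_congr_fun hAm fun z hz => ?_
    have h1 : 0 < ‖u z‖ := norm_pos_iff.2 (hune z (hAball hz) (hA0 z hz))
    have h2 : 0 < ‖z‖ := norm_pos_iff.2 (hA0 z hz)
    rw [hslope z (hA0 z hz), ← ENNReal.ofReal_mul (by positivity), norm_div, norm_div]
    congr 1
    field_simp
  have hinj' : InjOn (fun z => (u z)⁻¹) A := fun x hx y hy h =>
    hinj (hAball hx) (hAball hy) (inv_injective h)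
  have harea2 : ∫⁻ z in A, ENNReal.ofReal (‖deriv u z / dslope u 0 z‖ ^ 2 / ‖z‖ ^ 2) =
      ∫⁻ y in (fun z => (u z)⁻¹) '' A, ENNReal.ofReal (1 / ‖y‖ ^ 2) := by
    rw [lintegral_image_eq_lintegral_norm_deriv_sq (f := fun z => (u z)⁻¹) hAm
      (fun z hz => (hud z (hAball hz)).inv (hune z (hAball hz) (hA0 z hz))) hinj']
    refine setLIntegral_congr_fun hAm fun z hz => ?_
    have h1 : 0 < ‖u z‖ := norm_pos_iff.2 (hune z (hAball hz) (hA0 z hz))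
    have h2 : 0 < ‖z‖ := norm_pos_iff.2 (hA0 z hz)
    rw [hslope z (hA0 z hz), ← ENNReal.ofReal_mul (by positivity), norm_div, norm_div,
      ((hud z (hAball hz)).hasDerivAt.fun_inv (hune z (hAball hz) (hA0 z hz))).deriv,
      norm_div, norm_neg, norm_pow, norm_inv]
    congr 1
    field_simp
  have hmeas : MeasurableSet ((fun z => (u z)⁻¹) '' A) :=
    hAm.image_of_continuousOn_injOn ((hu.continuousOn.mono hAball).inv₀
      fun z hz => hune z (hAball hz) (hA0 z hz)) hinj'
  have hdisj : Disjoint (u '' A) ((fun z => (u z)⁻¹) '' A) := by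
    rw [Set.disjoint_left]
    rintro _ ⟨z, hz, rfl⟩ ⟨w, hw, hwz⟩
    refine hmul z (hAball hz) w (hAball hw) ?_
    rw [← hwz]
    exact inv_mul_cancel₀ (hune w (hAball hw) (hA0 w hw))
  have hbd : ∀ z ∈ A, s < ‖u z‖ ∧ ‖u z‖ < 1 / s := fun z hz => by
    have h1 : 0 < ‖u z‖ := norm_pos_iff.2 (hune z (hAball hz) (hA0 z hz))
    refine ⟨hlow z (hAball hz) hz.1.le, ?_⟩
    by_contra! hcon
    obtain ⟨w, hw, hwz⟩ := hcov (show (u z)⁻¹ ∈ closedBall 0 s by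
      rw [mem_closedBall_zero_iff, norm_inv, inv_le_comm₀ h1 hs0]
      simpa using hcon)
    refine hmul w hw z (hAball hz) ?_
    rw [hwz]
    exact inv_mul_cancel₀ (norm_pos_iff.1 h1)
  have hsub : u '' A ∪ (fun z => (u z)⁻¹) '' A ⊆ {y | ‖y‖ ∈ Ioo s (1 / s)} := by
    rintro _ (⟨z, hz, rfl⟩ | ⟨z, hz, rfl⟩)
    · exact hbd z hz
    · obtain ⟨h1, h2⟩ := hbd z hz
      rw [mem_ofPred_eq, norm_inv]
      refine ⟨?_, ?_⟩
      · rw [lt_inv_comm₀ hs0 (hs0.trans h1)]; simpa using h2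
      · rw [one_div]; exact (inv_lt_inv₀ (hs0.trans h1) hs0).2 h1
  have hs1 : s ≤ 1 / s := by
    obtain ⟨t, ht1, ht2⟩ := exists_between hε.2
    have := hbd t (by
      rw [hA, mem_ofPred_eq, Complex.norm_real, Real.norm_eq_abs, abs_of_pos (hε.1.trans ht1)]
      exact ⟨ht1, ht2⟩)
    linarith
  have htot := calc
    ENNReal.ofReal (2 * π * Real.log (1 / ε)) + ENNReal.ofReal (2 * π * Real.log (1 / ε))
      ≤ (∫⁻ y in u '' A, ENNReal.ofReal (1 / ‖y‖ ^ 2)) +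
        ∫⁻ y in (fun z => (u z)⁻¹) '' A, ENNReal.ofReal (1 / ‖y‖ ^ 2) :=
        add_le_add (harea1 ▸ hmain) (harea2 ▸ hmain)
    _ = ∫⁻ y in u '' A ∪ (fun z => (u z)⁻¹) '' A, ENNReal.ofReal (1 / ‖y‖ ^ 2) :=
        (lintegral_union hmeas hdisj).symm
    _ ≤ ∫⁻ y : ℂ in {y | ‖y‖ ∈ Ioo s (1 / s)}, ENNReal.ofReal (1 / ‖y‖ ^ 2) :=
        lintegral_mono_set hsub
    _ = ENNReal.ofReal (2 * π * Real.log (1 / s / s)) := lintegral_annulus_inv_sq hs0 hs1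
  have hlogε : 0 ≤ Real.log (1 / ε) := Real.log_nonneg ((one_le_div hε.1).2 hε.2.le)
  have hlogs : 0 ≤ Real.log (1 / s / s) := Real.log_nonneg ((one_le_div hs0).2 hs1)
  rw [← ENNReal.ofReal_add (by positivity) (by positivity),
    ENNReal.ofReal_le_ofReal_iff (by positivity)] at htot
  rw [one_div, Real.log_div (by positivity) hs0.ne', one_div, Real.log_inv, Real.log_inv] at htot
  have hlog : Real.log ε < Real.log s := Real.log_lt_log hε.1 (by nlinarith [hε.1])
  nlinarith [Real.pi_pos]

/-- A nonvanishing holomorphic function on a disc has a holomorphic square root. -/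
theorem exists_differentiableOn_sq_eq {F : ℂ → ℂ} {r : ℝ} (hr : 0 < r)
    (hF : DifferentiableOn ℂ F (ball 0 r)) (hF0 : F 0 = 1) (hne : ∀ z ∈ ball (0 : ℂ) r, F z ≠ 0) :
    ∃ h : ℂ → ℂ, DifferentiableOn ℂ h (ball 0 r) ∧ h 0 = 1 ∧
      ∀ z ∈ ball (0 : ℂ) r, h z ^ 2 = F z := by
  have hd : DifferentiableOn ℂ (fun z => deriv F z / F z) (ball 0 r) :=
    (hF.deriv isOpen_ball).div hF hne
  obtain ⟨L, hL0, hL⟩ := hd.isExactOn_ball.with_val_at 0 0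
  have hder : ∀ z ∈ ball (0 : ℂ) r,
      HasDerivAt (fun z => F z * Complex.exp (-L z)) 0 z := by
    intro z hz
    have h1 := (hF.differentiableAt (isOpen_ball.mem_nhds hz)).hasDerivAt
    have h2 := h1.mul (hL z hz).neg.cexp
    refine h2.congr_deriv ?_
    have := hne z hz
    field_simp
    ring
  have hconst : ∀ z ∈ ball (0 : ℂ) r, F z * Complex.exp (-L z) = 1 := by
    intro z hz
    have h := isOpen_ball.is_const_of_deriv_eq_zero (convex_ball (0 : ℂ) r).isPreconnected
      (fun z hz => (hder z hz).differentiableAt.differentiableWithinAt)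
      (fun z hz => (hder z hz).deriv) hz (mem_ball_self hr)
    simpa [hL0, hF0] using h
  refine ⟨fun z => Complex.exp (L z / 2), fun z hz =>
    ((hL z hz).div_const 2).cexp.differentiableAt.differentiableWithinAt, by simp [hL0], ?_⟩
  intro z hz
  have h := hconst z hz
  rw [Complex.exp_neg] at h
  have he := Complex.exp_ne_zero (L z)
  rw [← Complex.exp_nat_mul]
  field_simp at h
  rw [h]
  congr 1
  push_cast
  ring

/-- The Koebe one-quarter theorem, for functions on the unit disc vanishing at the origin. -/
theorem norm_deriv_le_four_mul_of_notMem_image_ball {f : ℂ → ℂ}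
    (hf : DifferentiableOn ℂ f (ball 0 1)) (hinj : InjOn f (ball 0 1)) (hf0 : f 0 = 0)
    {p : ℂ} (hp : p ∉ f '' ball 0 1) : ‖deriv f 0‖ ≤ 4 * ‖p‖ := by
  have h0 : (0 : ℂ) ∈ ball (0 : ℂ) 1 := mem_ball_self one_pos
  have hp0 : p ≠ 0 := by
    rintro rfl
    exact hp ⟨0, h0, hf0⟩
  have hFd : DifferentiableOn ℂ (fun z => 1 - f z / p) (ball 0 1) := by fun_prop
  obtain ⟨h, hd, hh0, hsq⟩ := exists_differentiableOn_sq_eq one_pos hFd (by simp [hf0])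
    (fun z hz hzero => hp ⟨z, hz, by
      have : f z / p = 1 := (sub_eq_zero.mp hzero).symm
      rwa [div_eq_one_iff_eq hp0] at this⟩)
  have heq : ∀ z ∈ ball (0 : ℂ) 1, ∀ w ∈ ball (0 : ℂ) 1, h z ^ 2 = h w ^ 2 → z = w := by
    intro z hz w hw hzw
    rw [hsq z hz, hsq w hw] at hzw
    refine hinj hz hw ?_
    field_simp at hzw
    linear_combination -hzw
  have hne : ∀ z ∈ ball (0 : ℂ) 1, h z ≠ 0 := by
    intro z hz hzero
    have h1 := hsq z hz
    rw [hzero] at h1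
    refine hp ⟨z, hz, ?_⟩
    field_simp at h1
    linear_combination h1
  have hneg : ∀ z ∈ ball (0 : ℂ) 1, ∀ w ∈ ball (0 : ℂ) 1, h z + h w ≠ 0 := by
    intro z hz w hw hzw
    have h1 : h z = -h w := eq_neg_of_add_eq_zero_left hzw
    have h2 := heq z hz w hw (by rw [h1]; ring)
    subst h2
    refine hne z hz ?_
    linear_combination hzw / 2
  have hone : ∀ z ∈ ball (0 : ℂ) 1, 1 + h z ≠ 0 := fun z hz => hh0 ▸ hneg 0 h0 z hz
  have hud : DifferentiableOn ℂ (fun z => (1 - h z) / (1 + h z)) (ball 0 1) :=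
    (hd.const_sub 1).div (hd.const_add 1) hone
  have hkey := norm_deriv_le_one_of_mul_ne_one hud
    (by
      intro z hz w hw hzw
      have h1 := hone z hz
      have h2 := hone w hw
      refine heq z hz w hw ?_
      have h3 : h z = h w := by
        simp only at hzw
        rw [div_eq_div_iff h1 h2] at hzw
        linear_combination -hzw / 2
      rw [h3])
    (by simp [hh0])
    (by
      intro z hz w hw hzw
      have h1 := hone z hz
      have h2 := hone w hw
      refine hneg z hz w hw ?_
      rw [div_mul_div_comm, div_eq_one_iff_eq (mul_ne_zero h1 h2)] at hzw
      linear_combination -hzw / 2)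
  have hh : HasDerivAt h (deriv h 0) 0 :=
    (hd.differentiableAt (isOpen_ball.mem_nhds h0)).hasDerivAt
  have hfd : HasDerivAt f (deriv f 0) 0 :=
    (hf.differentiableAt (isOpen_ball.mem_nhds h0)).hasDerivAt
  have hu : HasDerivAt (fun z => (1 - h z) / (1 + h z)) (-deriv h 0 / 2) 0 := by
    refine ((hh.const_sub 1).div (hh.const_add 1) (hone 0 h0)).congr_deriv ?_
    rw [hh0]
    ring
  have hrel : 2 * deriv h 0 = -(deriv f 0 / p) := by
    have h1 : HasDerivAt (fun z => h z ^ 2) (2 * deriv h 0) 0 :=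
      (hh.pow 2).congr_deriv (by simp [hh0])
    have h2 : HasDerivAt (fun z => h z ^ 2) (-(deriv f 0 / p)) 0 := by
      refine ((hfd.div_const p).const_sub 1).congr_of_eventuallyEq ?_
      filter_upwards [isOpen_ball.mem_nhds h0] with z hz using hsq z hz
    exact h1.unique h2
  rw [hu.deriv, show -deriv h 0 / 2 = deriv f 0 / p / 4 by linear_combination -hrel / 4, norm_div,
    norm_div] at hkey
  have hpn : 0 < ‖p‖ := norm_pos_iff.mpr hp0
  have h4 : ‖(4 : ℂ)‖ = 4 := by simp
  rw [h4, div_div, div_le_one (by positivity)] at hkey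
  linarith

/-- The Koebe one-quarter theorem on an arbitrary disc. -/
theorem norm_deriv_mul_le_of_notMem_image_ball {f : ℂ → ℂ} {x : ℂ} {ρ : ℝ} (hρ : 0 < ρ)
    (hf : DifferentiableOn ℂ f (ball x ρ)) (hinj : InjOn f (ball x ρ))
    {p : ℂ} (hp : p ∉ f '' ball x ρ) : ‖deriv f x‖ * ρ ≤ 4 * ‖f x - p‖ := by
  have hmap : MapsTo (fun z : ℂ => x + ρ * z) (ball 0 1) (ball x ρ) := by
    intro z hz
    simp only [mem_ball, dist_zero_right, dist_self_add_left, norm_mul, Complex.norm_real,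
      Real.norm_eq_abs, abs_of_pos hρ] at hz ⊢
    nlinarith
  have hρ0 : (ρ : ℂ) ≠ 0 := by exact_mod_cast hρ.ne'
  have hder : HasDerivAt (fun z : ℂ => f (x + ρ * z) - f x) (deriv f x * ρ) 0 := by
    have h1 : HasDerivAt (fun z : ℂ => x + ρ * z) ρ 0 := by
      simpa using ((hasDerivAt_id (0 : ℂ)).const_mul (ρ : ℂ)).const_add x
    have h2 : HasDerivAt f (deriv f x) (x + ρ * 0) := by
      simpa using (hf.differentiableAt (isOpen_ball.mem_nhds (mem_ball_self hρ))).hasDerivAt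
    exact (h2.comp 0 h1).sub_const _
  have := norm_deriv_le_four_mul_of_notMem_image_ball (f := fun z : ℂ => f (x + ρ * z) - f x)
    (p := p - f x)
    ((hf.comp (by fun_prop) hmap).sub_const _)
    (by
      intro z hz w hw hzw
      have h1 := hinj (hmap hz) (hmap hw) (sub_left_injective hzw)
      exact mul_left_cancel₀ hρ0 (add_left_cancel h1))
    (by simp)
    (by
      rintro ⟨z, hz, hzp⟩
      exact hp ⟨_, hmap hz, sub_left_injective hzp⟩)
  rwa [hder.deriv, norm_mul, Complex.norm_real, Real.norm_eq_abs, abs_of_pos hρ,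
    norm_sub_rev p] at this

/-- An injective holomorphic function has a holomorphic inverse on its image. -/
theorem exists_differentiableOn_leftInvOn {f : ℂ → ℂ} {U : Set ℂ} (hU : IsOpen U)
    (hUc : IsPreconnected U) (hf : DifferentiableOn ℂ f U) (hinj : InjOn f U) :
    ∃ g : ℂ → ℂ, DifferentiableOn ℂ g (f '' U) ∧ LeftInvOn g f U := by
  have hg : LeftInvOn (Function.invFunOn f U) f U := hinj.leftInvOn_invFunOn
  set g := Function.invFunOn f U
  have hopen : ∀ {s : Set ℂ}, s ⊆ U → IsOpen s → IsOpen (f '' s) := fun hsU hs =>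
    isOpen_image_of_injOn_differentiableOn hU hUc hf hinj hsU hs
  have hcont : ∀ z ∈ U, ContinuousAt g (f z) := by
    intro z hz N hN
    rw [hg hz] at hN
    obtain ⟨t, htN, ht, hzt⟩ := _root_.mem_nhds_iff.mp hN
    rw [Filter.mem_map]
    filter_upwards [(hopen inter_subset_right (ht.inter hU)).mem_nhds ⟨z, ⟨hzt, hz⟩, rfl⟩]
    rintro _ ⟨y, ⟨hyt, hyU⟩, rfl⟩
    rw [mem_preimage, hg hyU]
    exact htN hyt
  have hright : ∀ z ∈ U, ∀ᶠ y in 𝓝 (f z), f (g y) = y := by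
    intro z hz
    filter_upwards [(hopen subset_rfl hU).mem_nhds ⟨z, hz, rfl⟩]
    rintro _ ⟨y, hy, rfl⟩
    rw [hg hy]
  have hreg : ∀ z ∈ U, deriv f z ≠ 0 → DifferentiableAt ℂ g (f z) := by
    intro z hz hz0
    refine (HasDerivAt.of_local_left_inverse (hcont z hz) ?_ hz0 (hright z hz)).differentiableAt
    rw [hg hz]
    exact (hf.differentiableAt (hU.mem_nhds hz)).hasDerivAt
  have hpunct : ∀ z ∈ U, ∀ᶠ y in 𝓝[≠] z, deriv f y ≠ 0 := by
    intro z hz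
    have han : AnalyticAt ℂ (deriv f) z := (hf.analyticAt (hU.mem_nhds hz)).deriv
    refine han.eventually_eq_zero_or_eventually_ne_zero.resolve_left fun h0 => ?_
    obtain ⟨ε, hε, hball⟩ := Metric.mem_nhds_iff.mp (h0.and (hU.mem_nhds hz))
    have hzb : z ∈ ball z ε := mem_ball_self hε
    have hne : z + (ε / 2 : ℝ) ∈ ball z ε := by
      rw [mem_ball, dist_self_add_left, Complex.norm_real, Real.norm_eq_abs, abs_of_pos (by positivity)]
      linarith
    have heq := isOpen_ball.is_const_of_deriv_eq_zero (convex_ball z ε).isPreconnected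
      (hf.mono fun y hy => (hball hy).2) (fun y hy => (hball hy).1) hne hzb
    have h1 := hinj (hball hne).2 (hball hzb).2 heq
    have h2 : ((ε / 2 : ℝ) : ℂ) = 0 := by simpa using h1
    have h3 : ε / 2 = 0 := by exact_mod_cast h2
    linarith
  refine ⟨g, ?_, hg⟩
  rintro _ ⟨z, hz, rfl⟩
  refine (Complex.analyticAt_of_differentiable_on_punctured_nhds_of_continuousAt ?_
    (hcont z hz)).differentiableAt.differentiableWithinAt
  have htend : Tendsto g (𝓝[≠] f z) (𝓝[≠] z) := by
    refine tendsto_nhdsWithin_iff.mpr ⟨?_, ?_⟩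
    · have := (hcont z hz).tendsto
      rw [hg hz] at this
      exact this.mono_left nhdsWithin_le_nhds
    · filter_upwards [(hright z hz).filter_mono nhdsWithin_le_nhds, self_mem_nhdsWithin]
        with y hy hyne hgy
      exact hyne (by rw [← hy, hgy]; rfl)
  filter_upwards [htend.eventually (hpunct z hz), (hright z hz).filter_mono nhdsWithin_le_nhds,
    nhdsWithin_le_nhds ((hopen subset_rfl hU).mem_nhds ⟨z, hz, rfl⟩)] with y hy1 hy2 hy3
  obtain ⟨x, hx, rfl⟩ := hy3
  rw [hg hx] at hy1
  exact hreg x hx hy1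

/-- The image of a set under a holomorphic function has length at most the integral over the set
of the modulus of the derivative. -/
theorem hausdorffMeasure_image_le_lintegral_norm_deriv {f : ℂ → ℂ} {U : Set ℂ} (hU : IsOpen U)
    (hf : DifferentiableOn ℂ f U) (s : Set ℂ) (hs : μH[1] (s ∩ U) ≠ ∞) :
    μH[1] (f '' (s ∩ U)) ≤
      ∫⁻ z in U, (‖deriv f z‖₊ : ℝ≥0∞) ∂((μH[1] : Measure ℂ).restrict s) := by
  rcases U.eq_empty_or_nonempty with rfl | hUne
  · simp
  set ν := (μH[1] : Measure ℂ).restrict s with hν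
  have hνU : ν U = μH[1] (s ∩ U) := by
    rw [hν, Measure.restrict_apply hU.measurableSet, inter_comm]
  have key : ∀ ε : ℝ≥0, 0 < ε → μH[1] (f '' (s ∩ U)) ≤
      (∫⁻ z in U, (‖deriv f z‖₊ : ℝ≥0∞) ∂ν) + (2 * ε : ℝ≥0) * ν U := by
    intro ε hε
    have hloc : ∀ z ∈ U, ∃ N : Set ℂ, IsOpen N ∧ z ∈ N ∧ N ⊆ U ∧
        LipschitzOnWith (‖deriv f z‖₊ + ε) f N ∧ ∀ y ∈ N, ‖deriv f z‖₊ ≤ ‖deriv f y‖₊ + ε := by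
      intro z hz
      have han : AnalyticAt ℂ f z := hf.analyticAt (hU.mem_nhds hz)
      have hstr : HasStrictDerivAt f (deriv f z) z := han.hasStrictDerivAt
      obtain ⟨t, ht, hlip⟩ := hstr.hasStrictFDerivAt.exists_lipschitzOnWith_of_nnnorm_lt
        (‖deriv f z‖₊ + ε) (by simpa using hε)
      have hcont : Tendsto (fun y => ‖deriv f y‖₊ + ε) (𝓝 z) (𝓝 (‖deriv f z‖₊ + ε)) :=
        (han.deriv.continuousAt.nnnorm).tendsto.add_const ε
      have hev := hcont.eventually (lt_mem_nhds (lt_add_of_pos_right (‖deriv f z‖₊) hε))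
      obtain ⟨N, hN, hNo, hzN⟩ := _root_.mem_nhds_iff.mp
        (Filter.inter_mem (Filter.inter_mem ht (hU.mem_nhds hz)) hev)
      exact ⟨N, hNo, hzN, fun y hy => (hN hy).1.2, hlip.mono fun y hy => (hN hy).1.1,
        fun y hy => le_of_lt (hN hy).2⟩
    choose! N hNo hzN hNU hlip hder using hloc
    obtain ⟨t, htU, htc, hcov⟩ := TopologicalSpace.countable_cover_nhdsWithin (f := N) (s := U)
      fun z hz => mem_nhdsWithin_of_mem_nhds ((hNo z hz).mem_nhds (hzN z hz))
    have htne : t.Nonempty := by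
      obtain ⟨z, hz⟩ := hUne
      obtain ⟨i, hi, -⟩ := mem_iUnion₂.mp (hcov hz)
      exact ⟨i, hi⟩
    obtain ⟨x, rfl⟩ := htc.exists_eq_range htne
    have hxU : ∀ n, x n ∈ U := fun n => htU (mem_range_self n)
    set D : ℕ → Set ℂ := disjointed fun n => N (x n) with hD
    have hDN : ∀ n, D n ⊆ N (x n) := disjointed_le _
    have hDm : ∀ n, MeasurableSet (D n) := fun n =>
      MeasurableSet.disjointed (fun n => (hNo _ (hxU n)).measurableSet) n
    have hDU : U = ⋃ n, D n := by
      rw [hD, iUnion_disjointed]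
      refine Subset.antisymm (fun z hz => ?_) (iUnion_subset fun n => hNU _ (hxU n))
      simpa using hcov hz
    have hpiece : ∀ n, μH[1] (f '' (s ∩ D n)) ≤
        ∫⁻ z in D n, ((‖deriv f z‖₊ : ℝ≥0∞) + (2 * ε : ℝ≥0)) ∂ν := by
      intro n
      calc μH[1] (f '' (s ∩ D n)) ≤ ((‖deriv f (x n)‖₊ + ε : ℝ≥0) : ℝ≥0∞) * μH[1] (s ∩ D n) := by
            simpa using ((hlip _ (hxU n)).mono
              (inter_subset_right.trans (hDN n))).hausdorffMeasure_image_le (s := s ∩ D n)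
                zero_le_one
        _ = ∫⁻ _ in D n, ((‖deriv f (x n)‖₊ + ε : ℝ≥0) : ℝ≥0∞) ∂ν := by
            rw [setLIntegral_const, hν, Measure.restrict_apply (hDm n), inter_comm]
        _ ≤ _ := by
            refine setLIntegral_mono' (hDm n) fun z hz => ?_
            have h1 := hder _ (hxU n) z (hDN n hz)
            have h2 : ‖deriv f (x n)‖₊ + ε ≤ ‖deriv f z‖₊ + 2 * ε := by
              rw [two_mul, ← add_assoc]
              gcongr
            exact_mod_cast h2
    calc μH[1] (f '' (s ∩ U)) = μH[1] (⋃ n, f '' (s ∩ D n)) := by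
          rw [← image_iUnion, ← inter_iUnion, ← hDU]
      _ ≤ ∑' n, μH[1] (f '' (s ∩ D n)) := measure_iUnion_le _
      _ ≤ ∑' n, ∫⁻ z in D n, ((‖deriv f z‖₊ : ℝ≥0∞) + (2 * ε : ℝ≥0)) ∂ν :=
          ENNReal.tsum_le_tsum hpiece
      _ = ∫⁻ z in U, ((‖deriv f z‖₊ : ℝ≥0∞) + (2 * ε : ℝ≥0)) ∂ν := by
          conv_rhs => rw [hDU]
          rw [lintegral_iUnion hDm (disjoint_disjointed _)]
      _ = _ := by
          rw [lintegral_add_right _ measurable_const, setLIntegral_const]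
  rw [← hνU] at hs
  lift ν U to ℝ≥0 using hs with M
  refine ENNReal.le_of_forall_pos_le_add fun ε hε _ => ?_
  refine (key (ε / (2 * (M + 1))) (by positivity)).trans ?_
  gcongr
  rw [← ENNReal.coe_mul]
  have h : 2 * (ε / (2 * (M + 1))) * M ≤ ε := by
    have h1 : 2 * (ε / (2 * (M + 1))) * M = ε * (M / (M + 1)) := by field_simp
    rw [h1]
    refine mul_le_of_le_one_right' ?_
    exact div_le_one_of_le₀ (by simp) (by positivity)
  exact_mod_cast h

theorem IsPreconnected.subset_of_disjoint_frontier {X : Type*} [TopologicalSpace X] {s u : Set X}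
    (hs : IsPreconnected s) (hu : IsOpen u) (hsu : (s ∩ u).Nonempty)
    (hd : Disjoint s (frontier u)) : s ⊆ u := by
  refine hs.subset_left_of_subset_union hu isClosed_closure.isOpen_compl
    (disjoint_compl_right_iff_subset.mpr subset_closure) (fun x hx => ?_) hsu
  by_cases hxu : x ∈ u
  · exact Or.inl hxu
  · refine Or.inr fun hxc => disjoint_left.mp hd hx ⟨hxc, ?_⟩
    rwa [hu.interior_eq]

/-- A circle contained in a simply connected domain cannot be centred outside the domain. -/
theorem not_sphere_subset_of_isSimplyConnected {Ω : Set ℂ} (hΩ : IsOpen Ω)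
    (hsc : IsSimplyConnected Ω) {a : ℂ} (ha : a ∉ Ω) {ρ : ℝ} (hρ : 0 < ρ) : ¬ sphere a ρ ⊆ Ω := by
  intro hsub
  obtain ⟨s, hsc, hs⟩ := Complex.exists_continuousOn_pow_eq hsc hΩ (g := fun z => z - a)
    (by fun_prop) (by rintro ⟨z, hz, hza⟩; exact ha (sub_eq_zero.mp hza ▸ hz)) two_ne_zero
  have hmem : ∀ θ : ℝ, circleMap a ρ θ ∈ Ω := fun θ => hsub (circleMap_mem_sphere a hρ.le θ)
  set q : ℝ → ℂ := fun θ => (Real.sqrt ρ : ℂ) * Complex.exp (θ / 2 * Complex.I) with hq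
  have hq0 : ∀ θ, q θ ≠ 0 := fun θ => by
    have : (Real.sqrt ρ : ℂ) ≠ 0 := by exact_mod_cast (Real.sqrt_pos.mpr hρ).ne'
    exact mul_ne_zero this (Complex.exp_ne_zero _)
  have hcont : ContinuousOn (fun θ : ℝ => s (circleMap a ρ θ)) univ :=
    hsc.comp (continuous_circleMap a ρ).continuousOn fun θ _ => hmem θ
  have hsq : EqOn ((fun θ : ℝ => s (circleMap a ρ θ)) ^ 2) (q ^ 2) univ := by
    intro θ _
    have h1 : (Real.sqrt ρ : ℂ) ^ 2 = ρ := by exact_mod_cast Real.sq_sqrt hρ.le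
    simp only [Pi.pow_apply, hq]
    rw [hs, mul_pow, h1, ← Complex.exp_nat_mul, circleMap, add_sub_cancel_left]
    congr 2
    push_cast
    ring
  have hper : circleMap a ρ (2 * π) = circleMap a ρ 0 := by
    simpa using periodic_circleMap a ρ 0
  have hqper : q (2 * π) = -q 0 := by
    simp only [hq]
    push_cast
    rw [mul_div_cancel_left₀ _ two_ne_zero, Complex.exp_pi_mul_I]
    simp
  have hz := hq0 0
  rcases isPreconnected_univ.eq_or_eq_neg_of_sq_eq hcont (by fun_prop) hsq fun _ => hq0 _
    with h | h
  · have h1 := h (mem_univ (2 * π))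
    have h2 := h (mem_univ 0)
    simp only [hper] at h1 h2
    rw [h1, hqper] at h2
    exact hz (by linear_combination -h2 / 2)
  · have h1 := h (mem_univ (2 * π))
    have h2 := h (mem_univ 0)
    simp only [hper, Pi.neg_apply] at h1 h2
    rw [h1, hqper] at h2
    exact hz (by linear_combination h2 / 2)

/-- A simply connected domain whose boundary has finite diameter `D` is contained in the open ball
of radius `D` around each of its boundary points. -/
theorem subset_ball_of_isSimplyConnected {Ω : Set ℂ} (hΩ : IsOpen Ω) (hne : Ω.Nonempty)
    (hsc : IsSimplyConnected Ω) (hD : ediam (frontier Ω) ≠ ∞) {z : ℂ} (hz : z ∈ frontier Ω) :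
    0 < (ediam (frontier Ω)).toReal ∧ Ω ⊆ ball z (ediam (frontier Ω)).toReal := by
  set D := (ediam (frontier Ω)).toReal
  have hzΩ : z ∉ Ω := fun h => by
    rw [hΩ.frontier_eq] at hz
    exact hz.2 h
  have hclosed : Ω ⊆ closedBall z D := by
    intro y hy
    by_contra hyD
    rw [mem_closedBall, not_le] at hyD
    have hD0 : 0 ≤ D := ENNReal.toReal_nonneg
    refine not_sphere_subset_of_isSimplyConnected hΩ hsc hzΩ (hD0.trans_lt hyD) ?_
    refine IsPreconnected.subset_of_disjoint_frontier
      (isPreconnected_sphere (Complex.rank_real_complex ▸ Nat.one_lt_ofNat) z _) hΩ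
      ⟨y, mem_sphere.mpr rfl, hy⟩ (disjoint_left.mpr fun x hx hxf => ?_)
    have h1 : edist x z ≤ ediam (frontier Ω) := Metric.edist_le_ediam_of_mem hxf hz
    have h2 : dist x z ≤ D := by
      rw [dist_edist]
      exact ENNReal.toReal_mono hD h1
    rw [mem_sphere.mp hx] at h2
    exact absurd h2 (not_le.mpr hyD)
  have hDpos : 0 < D := by
    refine lt_of_le_of_ne ENNReal.toReal_nonneg fun h0 => ?_
    obtain ⟨y, hy⟩ := hne
    have h1 := hclosed hy
    rw [← h0, closedBall_zero, mem_singleton_iff] at h1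
    exact hzΩ (h1 ▸ hy)
  refine ⟨hDpos, ?_⟩
  rw [← interior_closedBall z hDpos.ne']
  exact interior_maximal hclosed hΩ

theorem hausdorffMeasure_image_inter_le_pushForward {φ : ℂ → ℂ}
    (hφ : DifferentiableOn ℂ φ unitDisk) {γ : Set ℂ} (hγ : γ ⊆ unitDisk) (hfin : μH[1] γ ≠ ∞)
    {W : Set ℂ} (hW : IsOpen W) :
    μH[1] (φ '' γ ∩ W) ≤ pushForward unitDisk φ ((μH[1] : Measure ℂ).restrict γ) W := by
  set ν := (μH[1] : Measure ℂ).restrict γ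
  have hD : IsOpen unitDisk := isOpen_ball
  have hV : IsOpen (φ ⁻¹' W ∩ unitDisk) := by
    rw [inter_comm]
    exact hφ.continuousOn.isOpen_inter_preimage hD hW
  have hset : φ '' γ ∩ W = φ '' (γ ∩ (φ ⁻¹' W ∩ unitDisk)) := by
    rw [← image_inter_preimage, ← inter_assoc, inter_right_comm, inter_eq_left.mpr hγ]
  have hae : AEMeasurable φ ((ν.restrict unitDisk).withDensity fun z => (‖deriv φ z‖₊ : ℝ≥0∞)) :=
    (hφ.continuousOn.aemeasurable hD.measurableSet).mono_ac (withDensity_absolutelyContinuous _ _)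
  calc μH[1] (φ '' γ ∩ W) = μH[1] (φ '' (γ ∩ (φ ⁻¹' W ∩ unitDisk))) := by rw [hset]
    _ ≤ ∫⁻ z in φ ⁻¹' W ∩ unitDisk, (‖deriv φ z‖₊ : ℝ≥0∞) ∂ν :=
        hausdorffMeasure_image_le_lintegral_norm_deriv hV (hφ.mono inter_subset_right) γ
          (measure_ne_top_of_subset inter_subset_left hfin)
    _ = ∫⁻ z in φ ⁻¹' W, (‖deriv φ z‖₊ : ℝ≥0∞) ∂(ν.restrict unitDisk) := by
        rw [Measure.restrict_restrict' hD.measurableSet]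
    _ ≤ (ν.restrict unitDisk).withDensity (fun z => (‖deriv φ z‖₊ : ℝ≥0∞)) (φ ⁻¹' W) :=
        withDensity_apply_le _ _
    _ = pushForward unitDisk φ ν W := by
        rw [pushForward, Measure.map_apply_of_aemeasurable hae hW.measurableSet]

theorem carlesonNorm_restrict_le {D γ : Set ℂ} {C : ℝ} (hC : 0 ≤ C)
    (hreg : ∀ z : ℂ, ∀ r : ℝ, 0 < r → μH[1] (γ ∩ ball z r) ≤ ENNReal.ofReal (C * r)) :
    carlesonNorm D ((μH[1] : Measure ℂ).restrict γ) ≤ ENNReal.ofReal C := by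
  refine iSup₂_le fun z _ => iSup₂_le fun r hr => ENNReal.div_le_of_le_mul ?_
  rw [← ENNReal.ofReal_mul hC]
  refine (measure_mono inter_subset_right).trans ?_
  rw [Measure.restrict_apply measurableSet_ball, inter_comm]
  exact hreg z r hr.1

/-- The estimate for discs centred on the boundary. -/
theorem hausdorffMeasure_image_inter_ball_le_of_mem_frontier {φ : ℂ → ℂ} {Ω : Set ℂ}
    (hΩ : IsOpen Ω) (hne : Ω.Nonempty) (hsc : IsSimplyConnected Ω)
    (hφ : DifferentiableOn ℂ φ unitDisk) (honto : φ '' unitDisk = Ω) {T : ℝ} (hT : 0 ≤ T)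
    (hbound : ∀ ν : Measure ℂ, IsCarleson unitDisk ν →
      carlesonNorm Ω (pushForward unitDisk φ ν) ≤ ENNReal.ofReal T * carlesonNorm unitDisk ν)
    {γ : Set ℂ} (hγ : γ ⊆ unitDisk) {C : ℝ} (hC : 0 ≤ C)
    (hreg : ∀ z : ℂ, ∀ r : ℝ, 0 < r → μH[1] (γ ∩ ball z r) ≤ ENNReal.ofReal (C * r))
    {z : ℂ} (hz : z ∈ frontier Ω) {R : ℝ} (hR : 0 < R) :
    μH[1] (φ '' γ ∩ ball z R) ≤ ENNReal.ofReal (C * T * R) := by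
  have hΓ : φ '' γ ⊆ Ω := honto ▸ image_mono hγ
  have hfin : μH[1] γ ≠ ∞ := by
    have h := hreg 0 1 one_pos
    rw [inter_eq_left.mpr (show γ ⊆ ball 0 1 from hγ)] at h
    exact (h.trans_lt ENNReal.ofReal_lt_top).ne
  have hcar := carlesonNorm_restrict_le (D := unitDisk) hC hreg
  have hpush : carlesonNorm Ω (pushForward unitDisk φ ((μH[1] : Measure ℂ).restrict γ)) ≤
      ENNReal.ofReal (C * T) := by
    refine (hbound _ (hcar.trans_lt ENNReal.ofReal_lt_top)).trans ?_
    rw [mul_comm C, ENNReal.ofReal_mul hT]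
    gcongr
  have hsmall : ∀ r : ℝ, 0 < r → ENNReal.ofReal r < ediam (frontier Ω) →
      μH[1] (φ '' γ ∩ ball z r) ≤ ENNReal.ofReal (C * T * r) := by
    intro r hr hrD
    calc μH[1] (φ '' γ ∩ ball z r) = μH[1] (φ '' γ ∩ (Ω ∩ ball z r)) := by
          rw [← inter_assoc, inter_eq_left.mpr hΓ]
      _ ≤ pushForward unitDisk φ ((μH[1] : Measure ℂ).restrict γ) (Ω ∩ ball z r) :=
          hausdorffMeasure_image_inter_le_pushForward hφ hγ hfin (hΩ.inter isOpen_ball)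
      _ ≤ ENNReal.ofReal (C * T) * ENNReal.ofReal r := by
          rw [← ENNReal.div_le_iff (ENNReal.ofReal_pos.mpr hr).ne' ENNReal.ofReal_ne_top]
          refine le_trans ?_ hpush
          exact le_iSup₂_of_le z hz (le_iSup₂_of_le (ι := ℝ) r ⟨hr, hrD⟩ le_rfl)
      _ = ENNReal.ofReal (C * T * r) := (ENNReal.ofReal_mul (by positivity)).symm
  rcases lt_or_ge (ENNReal.ofReal R) (ediam (frontier Ω)) with h | h
  · exact hsmall R hR h
  have hDtop : ediam (frontier Ω) ≠ ∞ := (h.trans_lt ENNReal.ofReal_lt_top).ne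
  obtain ⟨hDpos, hsub⟩ := subset_ball_of_isSimplyConnected hΩ hne hsc hDtop hz
  have hDR : (ediam (frontier Ω)).toReal ≤ R := ENNReal.toReal_le_of_le_ofReal hR.le h
  set D := (ediam (frontier Ω)).toReal with hD
  have hDof : ENNReal.ofReal D = ediam (frontier Ω) := ENNReal.ofReal_toReal hDtop
  obtain ⟨u, humono, huD, hulim⟩ := exists_seq_strictMono_tendsto' hDpos
  have hcover : φ '' γ ∩ ball z R ⊆ ⋃ n, φ '' γ ∩ ball z (u n) := by
    rintro x ⟨hx, -⟩
    have hxD : dist x z < D := hsub (hΓ hx)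
    obtain ⟨n, hn⟩ := (hulim.eventually (lt_mem_nhds hxD)).exists
    exact mem_iUnion.mpr ⟨n, hx, hn⟩
  have hmono : Monotone fun n => φ '' γ ∩ ball z (u n) := fun m n hmn =>
    inter_subset_inter_right _ (ball_subset_ball (humono.monotone hmn))
  refine (measure_mono hcover).trans ?_
  rw [hmono.measure_iUnion]
  refine iSup_le fun n => (hsmall (u n) (huD n).1 ?_).trans ?_
  · rw [← hDof]
    exact (ENNReal.ofReal_lt_ofReal_iff hDpos).mpr (huD n).2
  · have := (huD n).2.le.trans hDR
    gcongr

theorem norm_deriv_le_of_notMem_image_ball {g : ℂ → ℂ} {w : ℂ} {d : ℝ} (hd : 0 < d)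
    (hg : DifferentiableOn ℂ g (ball w d)) (hinj : InjOn g (ball w d)) {p : ℂ}
    (hp : p ∉ g '' ball w d) {x : ℂ} (hx : x ∈ closedBall w (d / 5)) :
    ‖deriv g x‖ ≤ 5 / d * ‖g x - p‖ := by
  have hsub : ball x (4 * d / 5) ⊆ ball w d := by
    refine ball_subset_ball' ?_
    have := mem_closedBall.mp hx
    linarith
  have h := norm_deriv_mul_le_of_notMem_image_ball (x := x) (ρ := 4 * d / 5) (by positivity)
    (hg.mono hsub) (hinj.mono hsub) (fun h => hp (image_mono hsub h))
  rw [div_mul_eq_mul_div, le_div_iff₀ hd]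
  linarith

/-- A Harnack-type inequality for the distance to an omitted value of an injective holomorphic
function. -/
theorem norm_sub_le_exp_mul_of_notMem_image_ball {g : ℂ → ℂ} {w : ℂ} {d : ℝ} (hd : 0 < d)
    (hg : DifferentiableOn ℂ g (ball w d)) (hinj : InjOn g (ball w d)) {p : ℂ}
    (hp : p ∉ g '' ball w d) {x y : ℂ} (hx : x ∈ closedBall w (d / 5))
    (hy : y ∈ closedBall w (d / 5)) (hxy : ‖x - y‖ ≤ d / 5) :
    ‖g x - p‖ ≤ Real.exp 1 * ‖g y - p‖ := by
  have hseg : ∀ t ∈ Icc (0 : ℝ) 1, y + t * (x - y) ∈ closedBall w (d / 5) := by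
    intro t ht
    have := (convex_closedBall w (d / 5)).add_smul_sub_mem hy hx ht
    simpa using this
  have hsub : closedBall w (d / 5) ⊆ ball w d := closedBall_subset_ball (by linarith)
  have hder : ∀ t ∈ Icc (0 : ℝ) 1, HasDerivAt (fun t : ℝ => g (y + t * (x - y)) - p)
      (deriv g (y + t * (x - y)) * (x - y)) t := by
    intro t ht
    have h1 : HasDerivAt (fun z : ℂ => y + z * (x - y)) (x - y) (t : ℂ) := by
      simpa using ((hasDerivAt_id (t : ℂ)).mul_const (x - y)).const_add y
    have h2 := (hg.differentiableAt (isOpen_ball.mem_nhds (hsub (hseg t ht)))).hasDerivAt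
    exact ((h2.comp (t : ℂ) h1).comp_ofReal).sub_const p
  have h := norm_le_gronwallBound_of_norm_deriv_right_le (K := 1) (ε := 0) (δ := ‖g y - p‖)
    (fun t ht => (hder t ht).continuousAt.continuousWithinAt)
    (fun t ht => (hder t (Ico_subset_Icc_self ht)).hasDerivWithinAt)
    (by simp)
    (fun t ht => by
      have h1 := norm_deriv_le_of_notMem_image_ball hd hg hinj hp
        (hseg t (Ico_subset_Icc_self ht))
      rw [norm_mul, one_mul, add_zero]
      calc ‖deriv g (y + t * (x - y))‖ * ‖x - y‖
          ≤ (5 / d * ‖g (y + t * (x - y)) - p‖) * (d / 5) := by gcongr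
        _ = ‖g (y + t * (x - y)) - p‖ := by field_simp)
    1 (right_mem_Icc.mpr zero_le_one)
  rw [gronwallBound_ε0] at h
  simpa [mul_comm] using h

/-- The estimate for discs that are small compared with the distance to the boundary. -/
theorem hausdorffMeasure_image_inter_ball_le_of_ball_subset {φ : ℂ → ℂ}
    (hφ : DifferentiableOn ℂ φ unitDisk) (hinj : InjOn φ unitDisk)
    {γ : Set ℂ} (hγ : γ ⊆ unitDisk) {C : ℝ} (hC : 0 ≤ C)
    (hreg : ∀ z : ℂ, ∀ r : ℝ, 0 < r → μH[1] (γ ∩ ball z r) ≤ ENNReal.ofReal (C * r))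
    {w : ℂ} {d r : ℝ} (hw : ball w d ⊆ φ '' unitDisk) (hr : 0 < r) (hrd : r < d / 5) :
    μH[1] (φ '' γ ∩ ball w r) ≤ ENNReal.ofReal (54 * C * r) := by
  have hd : 0 < d := by linarith
  have hDo : IsOpen unitDisk := isOpen_ball
  obtain ⟨ψ, hψ, hψφ⟩ := exists_differentiableOn_leftInvOn hDo
    (convex_ball (0 : ℂ) 1).isPreconnected hφ hinj
  have hφψ : ∀ x ∈ ball w d, φ (ψ x) = x := by
    intro x hx
    obtain ⟨z, hz, rfl⟩ := hw hx
    rw [hψφ hz]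
  have hψd : DifferentiableOn ℂ ψ (ball w d) := hψ.mono hw
  have hψinj : InjOn ψ (ball w d) := fun x hx y hy hxy => by
    rw [← hφψ x hx, ← hφψ y hy, hxy]
  set G := ψ '' ball w d with hG
  have hGD : G ⊆ unitDisk := by
    rintro _ ⟨x, hx, rfl⟩
    obtain ⟨z, hz, rfl⟩ := hw hx
    rwa [hψφ hz]
  have hGo : IsOpen G := isOpen_image_of_injOn_differentiableOn isOpen_ball
    (convex_ball w d).isPreconnected hψd hψinj subset_rfl isOpen_ball
  have hGne : (Gᶜ).Nonempty := ⟨1, fun h => by simpa [unitDisk] using hGD h⟩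
  have hwd : w ∈ ball w d := mem_ball_self hd
  have hwc : w ∈ closedBall w (d / 5) := mem_closedBall_self (by positivity)
  obtain ⟨p₀, hp₀, hdist⟩ := hGo.isClosed_compl.exists_infDist_eq_dist hGne (ψ w)
  set δ := infDist (ψ w) Gᶜ with hδ
  have hδpos : 0 < δ :=
    (hGo.isClosed_compl.notMem_iff_infDist_pos hGne).mp fun h => h (mem_image_of_mem ψ hwd)
  have hrball : ball w r ⊆ closedBall w (d / 5) :=
    ball_subset_closedBall.trans (closedBall_subset_closedBall hrd.le)
  have hrd' : ball w r ⊆ ball w d := ball_subset_ball (by linarith)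
  have hψder : ∀ x ∈ ball w r, ‖deriv ψ x‖ ≤ 5 * Real.exp 1 * δ / d := by
    intro x hx
    have h1 := norm_deriv_le_of_notMem_image_ball hd hψd hψinj hp₀ (hrball hx)
    have h2 := norm_sub_le_exp_mul_of_notMem_image_ball hd hψd hψinj hp₀ (hrball hx) hwc
      (by rw [← dist_eq_norm]; exact mem_closedBall.mp (hrball hx))
    rw [← dist_eq_norm (ψ w), ← hdist] at h2
    calc ‖deriv ψ x‖ ≤ 5 / d * ‖ψ x - p₀‖ := h1
      _ ≤ 5 / d * (Real.exp 1 * δ) := by gcongr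
      _ = 5 * Real.exp 1 * δ / d := by ring
  have hψball : ∀ x ∈ ball w r, ψ x ∈ ball (ψ w) (5 * Real.exp 1 * δ / d * r) := by
    intro x hx
    rw [mem_ball, dist_eq_norm]
    have h1 := (convex_ball w r).norm_image_sub_le_of_norm_deriv_le
      (fun y hy => hψd.differentiableAt (isOpen_ball.mem_nhds (hrd' hy))) hψder
      (mem_ball_self hr) hx
    refine h1.trans_lt ?_
    have h2 : ‖x - w‖ < r := by rwa [← dist_eq_norm]
    gcongr
  have hφder : ∀ x ∈ ball w r, ‖deriv φ (ψ x)‖ ≤ 6 * d / 5 * Real.exp 1 / δ := by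
    intro x hx
    have hballG : ball (ψ x) (δ / Real.exp 1) ⊆ G := by
      intro p hp
      by_contra hpG
      have h1 := norm_sub_le_exp_mul_of_notMem_image_ball hd hψd hψinj hpG hwc (hrball hx)
        (by rw [norm_sub_rev, ← dist_eq_norm]; exact mem_closedBall.mp (hrball hx))
      have h2 : δ ≤ ‖ψ w - p‖ := by
        rw [← dist_eq_norm]
        exact infDist_le_dist_of_mem hpG
      rw [mem_ball, dist_comm, dist_eq_norm, lt_div_iff₀ (Real.exp_pos 1)] at hp
      linarith
    have hmaps : MapsTo φ (ball (ψ x) (δ / Real.exp 1)) (ball (φ (ψ x)) (6 * d / 5)) := by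
      intro z hz
      obtain ⟨y, hy, rfl⟩ := hballG hz
      rw [hφψ y hy, hφψ x (hrd' hx)]
      have h1 := mem_ball.mp hy
      have h2 := mem_ball'.mp hx
      have h3 := dist_triangle y w x
      rw [mem_ball]
      linarith
    refine (Complex.norm_deriv_le_div_of_mapsTo_ball (hφ.mono (hballG.trans hGD))
      (hmaps.mono_right ball_subset_closedBall)
      (by positivity)).trans (le_of_eq ?_)
    field_simp
  have hV : IsOpen (unitDisk ∩ φ ⁻¹' ball w r) :=
    hφ.continuousOn.isOpen_inter_preimage hDo isOpen_ball
  have hset : φ '' γ ∩ ball w r = φ '' (γ ∩ (unitDisk ∩ φ ⁻¹' ball w r)) := by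
    rw [← image_inter_preimage, ← inter_assoc, inter_eq_left.mpr hγ]
  have hfin : μH[1] γ ≠ ∞ := by
    have h := hreg 0 1 one_pos
    rw [inter_eq_left.mpr (show γ ⊆ ball 0 1 from hγ)] at h
    exact (h.trans_lt ENNReal.ofReal_lt_top).ne
  have hVsub : unitDisk ∩ φ ⁻¹' ball w r ⊆ ball (ψ w) (5 * Real.exp 1 * δ / d * r) := by
    rintro z ⟨hz, hzr⟩
    have := hψball _ hzr
    rwa [hψφ hz] at this
  calc μH[1] (φ '' γ ∩ ball w r)
      ≤ ∫⁻ z in unitDisk ∩ φ ⁻¹' ball w r, (‖deriv φ z‖₊ : ℝ≥0∞)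
          ∂((μH[1] : Measure ℂ).restrict γ) := by
        rw [hset]
        exact hausdorffMeasure_image_le_lintegral_norm_deriv hV (hφ.mono inter_subset_left) γ
          (measure_ne_top_of_subset inter_subset_left hfin)
    _ ≤ ∫⁻ _ in unitDisk ∩ φ ⁻¹' ball w r, ENNReal.ofReal (6 * d / 5 * Real.exp 1 / δ)
          ∂((μH[1] : Measure ℂ).restrict γ) := by
        refine setLIntegral_mono' hV.measurableSet fun z hz => ?_
        have h1 := hφder _ hz.2
        rw [hψφ hz.1] at h1
        rw [← enorm_eq_nnnorm, ← ofReal_norm]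
        exact ENNReal.ofReal_le_ofReal h1
    _ = ENNReal.ofReal (6 * d / 5 * Real.exp 1 / δ) *
          μH[1] ((unitDisk ∩ φ ⁻¹' ball w r) ∩ γ) := by
        rw [setLIntegral_const, Measure.restrict_apply hV.measurableSet]
    _ ≤ ENNReal.ofReal (6 * d / 5 * Real.exp 1 / δ) *
          ENNReal.ofReal (C * (5 * Real.exp 1 * δ / d * r)) := by
        gcongr
        refine (measure_mono ?_).trans (hreg (ψ w) _ (by positivity))
        exact fun z hz => ⟨hz.2, hVsub hz.1⟩
    _ = ENNReal.ofReal (6 * Real.exp 1 ^ 2 * C * r) := by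
        rw [← ENNReal.ofReal_mul (by positivity)]
        congr 1
        field_simp
    _ ≤ ENNReal.ofReal (54 * C * r) := by
        refine ENNReal.ofReal_le_ofReal ?_
        have h1 : Real.exp 1 ≤ 3 := Real.exp_one_lt_three.le
        have h2 : Real.exp 1 ^ 2 ≤ 3 ^ 2 := by gcongr
        have h3 : 6 * Real.exp 1 ^ 2 ≤ 54 := by linarith
        gcongr

end Auxiliary

/-- If the push-forward operator is well-defined (with operator norm
bound `normT`) and `γ ⊆ Δ` is Ahlfors-regular with constant `C`, then `Γ = φ(γ)` is
Ahlfors-regular with constant `2·max{3C‖T‖, 27C}`. -/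
theorem stmt_2 (φ : ℂ → ℂ) (Ω : Set ℂ)
    (hΩopen : IsOpen Ω) (hΩne : Ω.Nonempty) (hΩproper : Ω ≠ Set.univ)
    (hΩconn : IsConnected Ω) (hΩsc : SimplyConnectedSpace Ω)
    (hdiff : DifferentiableOn ℂ φ unitDisk)
    (hinj : Set.InjOn φ unitDisk)
    (honto : φ '' unitDisk = Ω)
    (normT : ℝ) (hT : 0 ≤ normT)
    (hwd : ∀ ν : Measure ℂ, IsCarleson unitDisk ν →
      IsCarleson Ω (pushForward unitDisk φ ν))
    (hbound : ∀ ν : Measure ℂ, IsCarleson unitDisk ν →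
      carlesonNorm Ω (pushForward unitDisk φ ν) ≤
        ENNReal.ofReal normT * carlesonNorm unitDisk ν)
    (γ : Set ℂ) (hγ : γ ⊆ unitDisk) (C : ℝ) (hC : 0 < C)
    (hreg : ∀ z : ℂ, ∀ r : ℝ, 0 < r →
      μH[1] (γ ∩ Metric.ball z r) ≤ ENNReal.ofReal (C * r)) :
    ∀ w : ℂ, ∀ r : ℝ, 0 < r →
      μH[1] (φ '' γ ∩ Metric.ball w r) ≤
        ENNReal.ofReal (2 * max (3 * C * normT) (27 * C) * r) := by
  have hbdry : ∀ z ∈ frontier Ω, ∀ R : ℝ, 0 < R →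
      μH[1] (φ '' γ ∩ ball z R) ≤ ENNReal.ofReal (C * normT * R) := fun z hz R hR =>
    hausdorffMeasure_image_inter_ball_le_of_mem_frontier hΩopen hΩne hΩsc hdiff honto hT hbound hγ
      hC.le hreg hz hR
  have hΓ : φ '' γ ⊆ Ω := honto ▸ image_mono hγ
  have hCT : 0 ≤ C * normT := by positivity
  intro w r hr
  have hmax₁ := le_max_left (3 * C * normT) (27 * C)
  have hmax₂ := le_max_right (3 * C * normT) (27 * C)
  have hnear : ∀ z ∈ frontier Ω, dist w z ≤ 5 * r →
      μH[1] (φ '' γ ∩ ball w r) ≤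
        ENNReal.ofReal (2 * max (3 * C * normT) (27 * C) * r) := by
    intro z hz hwz
    have hsub : ball w r ⊆ ball z (6 * r) := ball_subset_ball' (by linarith)
    refine (measure_mono (inter_subset_inter_right _ hsub)).trans
      ((hbdry z hz _ (by positivity)).trans (ENNReal.ofReal_le_ofReal ?_))
    calc C * normT * (6 * r) = 2 * (3 * C * normT) * r := by ring
      _ ≤ _ := by gcongr
  by_cases hwΩ : w ∈ Ω
  · obtain ⟨z, hz, hzd⟩ := exists_mem_frontier_infDist_compl_eq_dist hwΩ hΩproper
    rcases le_or_gt (dist w z) (5 * r) with h | h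
    · exact hnear z hz h
    have hsub : ball w (dist w z) ⊆ φ '' unitDisk := by
      rw [honto, ← hzd]
      exact ball_infDist_compl_subset
    refine (hausdorffMeasure_image_inter_ball_le_of_ball_subset hdiff hinj hγ hC.le hreg hsub hr
      (by linarith)).trans (ENNReal.ofReal_le_ofReal ?_)
    calc 54 * C * r = 2 * (27 * C) * r := by ring
      _ ≤ _ := by gcongr
  · rcases (ball w r ∩ Ω).eq_empty_or_nonempty with h | h
    · have hempty : φ '' γ ∩ ball w r = ∅ :=
        subset_empty_iff.mp fun x hx => h.subset ⟨hx.2, hΓ hx.1⟩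
      simp [hempty]
    · have hnd : ¬ Disjoint (ball w r) (frontier Ω) := fun hd => hwΩ
        (IsPreconnected.subset_of_disjoint_frontier (convex_ball w r).isPreconnected hΩopen h hd
          (mem_ball_self hr))
      obtain ⟨z, hzw, hz⟩ := not_disjoint_iff.mp hnd
      have := mem_ball'.mp hzw
      exact hnear z hz (by linarith)
end
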